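/- arXiv:1007.1812 — 9 statements merged into one kernel-verified Lean document; each statement's English description precedes it below -/
import Mathlib

section
/- Let m ≥ 2 be an integer and z a real with 0 ≤ z < 1. The vector p^z (with p^z_i = (1-z)^{i-1}/∑_{r=0}^{m-1}(1-z)^r) is a fully mixed mixed strategy for the row player in the matrix game M_z: all its entries are strictly positive, they sum to 1, and it equalizes all columns, i.e. for every column j ∈ {1,…,m} one has ∑_{i=1}^m p^z_i (M_z)_{i,j} = v_z, where v_z = 1/∑_{r=0}^{m-1}(1-z)^r. In particular, against every mixed strategy q of the column player, the row player using p^z receives payoff exactly v_z. -/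
theorem aux_col (z : ℝ) (j n : ℕ) :
    ∑ i ∈ Finset.range n, (1 - z) ^ i * (if i = j then (1:ℝ) else if i < j then z else 0)
      = if n ≤ j then 1 - (1 - z) ^ n else 1 := by
  induction n with
  | zero => simp
  | succ n ih =>
    rw [Finset.sum_range_succ, ih]
    rcases lt_trichotomy n j with h | h | h
    · rw [if_pos h.le, if_neg h.ne, if_pos h, if_pos (by omega)]
      ring
    · subst h
      simp
    · rw [if_neg (by omega), if_neg (by omega), if_neg (by omega), if_neg (by omega)]
      ring

/-- Let `m ≥ 2` and `0 ≤ z < 1`. The vector `p^z` with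
`p^z_i = (1-z)^{i-1} / ∑_{r=0}^{m-1} (1-z)^r` is a fully mixed strategy for the
row player in the matrix game `M_z` (the `m×m` matrix with `1` on the diagonal,
`z` above it and `0` below it): all its entries are strictly positive, they sum
to `1`, and it equalizes all columns to the value `v_z = 1/∑_{r=0}^{m-1}(1-z)^r`.
In particular, against every mixed strategy `q` of the column player, the row
player using `p^z` receives payoff exactly `v_z`. -/
theorem stmt0 (m : ℕ) (hm : 2 ≤ m) (z : ℝ) (hz0 : 0 ≤ z) (hz1 : z < 1)
    (M : Fin m → Fin m → ℝ)
    (hM : ∀ i j : Fin m, M i j = if i = j then 1 else if (i : ℕ) < (j : ℕ) then z else 0)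
    (v : ℝ) (hv : v = 1 / ∑ r ∈ Finset.range m, (1 - z) ^ r)
    (p : Fin m → ℝ) (hp : ∀ i : Fin m, p i = v * (1 - z) ^ (i : ℕ)) :
    (∀ i : Fin m, 0 < p i) ∧
    (∑ i : Fin m, p i = 1) ∧
    (∀ j : Fin m, ∑ i : Fin m, p i * M i j = v) ∧
    (∀ q : Fin m → ℝ, (∀ j : Fin m, 0 ≤ q j) → (∑ j : Fin m, q j = 1) →
      ∑ i : Fin m, ∑ j : Fin m, p i * M i j * q j = v) := by
  have hw : 0 < 1 - z := by linarith
  have hS : 0 < ∑ r ∈ Finset.range m, (1 - z) ^ r :=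
    Finset.sum_pos (fun i _ => pow_pos hw i) ⟨0, Finset.mem_range.2 (by omega)⟩
  have hvpos : 0 < v := by rw [hv]; positivity
  have hcol : ∀ j : Fin m, ∑ i : Fin m, p i * M i j = v := by
    intro j
    have h := aux_col z j m
    rw [if_neg (by have := j.2; omega), Finset.sum_range] at h
    calc ∑ i : Fin m, p i * M i j
        = v * ∑ i : Fin m, (1 - z) ^ (i : ℕ) *
            (if (i : ℕ) = (j : ℕ) then (1:ℝ) else if (i : ℕ) < (j : ℕ) then z else 0) := by
          rw [Finset.mul_sum]
          refine Finset.sum_congr rfl fun i _ => ?_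
          rw [hp, hM, mul_assoc]
          simp only [Fin.ext_iff]
      _ = v := by rw [h, mul_one]
  refine ⟨fun i => ?_, ?_, hcol, ?_⟩
  · rw [hp]
    exact mul_pos hvpos (pow_pos hw _)
  · simp only [hp]
    rw [← Finset.mul_sum, ← Finset.sum_range (fun i => (1 - z) ^ i), hv]
    exact one_div_mul_cancel hS.ne'
  · intro q _ hq
    rw [Finset.sum_comm]
    simp only [← Finset.sum_mul, hcol]
    rw [← Finset.mul_sum, hq, mul_one]
end

section
/- Let m ≥ 2 be an integer and z a real with 0 ≤ z < 1. Define q^z ∈ ℝ^m by q^z_j := v_z·(1-z)^{m-j}. Then q^z is a mixed strategy for the column player in the matrix game M_z, and it equalizes all rows: for every row i ∈ {1,…,m}, ∑_{j=1}^m (M_z)_{i,j} q^z_j = v_z. Consequently the matrix game M_z has value v_z: for every mixed strategy p of the row player and every mixed strategy q of the column player, pᵀ M_z q^z ≤ v_z ≤ (p^z)ᵀ M_z q. -/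
theorem core_aux (z : ℝ) (k n : ℕ) :
    ∑ i ∈ Finset.range n, (if i = k then 1 else if i < k then z else 0) * (1 - z) ^ i
      = if k < n then 1 else 1 - (1 - z) ^ n := by
  induction n with
  | zero => simp
  | succ n ih =>
    rw [Finset.sum_range_succ, ih]
    rcases lt_trichotomy n k with h | h | h
    · rw [if_neg (by omega), if_neg (by omega), if_pos h, if_neg (by omega)]
      ring
    · subst h
      simp
    · rw [if_pos h, if_neg (by omega), if_neg (by omega), if_pos (by omega)]
      ring

theorem core_fin (z : ℝ) (m : ℕ) (k : Fin m) :
    ∑ i : Fin m, (if i = k then 1 else if (i : ℕ) < (k : ℕ) then z else 0) * (1 - z) ^ (i : ℕ)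
      = 1 := by
  have h := core_aux z k m
  rw [if_pos k.2, Finset.sum_range] at h
  simpa only [Fin.ext_iff] using h

/-- Let `m ≥ 2` and `0 ≤ z < 1`. The vector `q^z` with
`q^z_j = v_z·(1-z)^{m-j}` is a mixed strategy for the column player in the matrix
game `M_z`, and it equalizes all rows: every row receives exactly
`v_z = 1/∑_{r=0}^{m-1}(1-z)^r` against it. Consequently the matrix game `M_z`
has value `v_z`: for every mixed strategy `p` of the row player and every mixed
strategy `q` of the column player, `pᵀ M_z q^z ≤ v_z ≤ (p^z)ᵀ M_z q`. -/
theorem stmt1 (m : ℕ) (hm : 2 ≤ m) (z : ℝ) (hz0 : 0 ≤ z) (hz1 : z < 1)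
    (M : Fin m → Fin m → ℝ)
    (hM : ∀ i j : Fin m, M i j = if i = j then 1 else if (i : ℕ) < (j : ℕ) then z else 0)
    (v : ℝ) (hv : v = 1 / ∑ r ∈ Finset.range m, (1 - z) ^ r)
    (p : Fin m → ℝ) (hp : ∀ i : Fin m, p i = v * (1 - z) ^ (i : ℕ))
    (q : Fin m → ℝ) (hq : ∀ j : Fin m, q j = v * (1 - z) ^ (m - 1 - (j : ℕ))) :
    (∀ j : Fin m, 0 ≤ q j) ∧
    (∑ j : Fin m, q j = 1) ∧
    (∀ i : Fin m, ∑ j : Fin m, M i j * q j = v) ∧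
    (∀ p' : Fin m → ℝ, (∀ i : Fin m, 0 ≤ p' i) → (∑ i : Fin m, p' i = 1) →
      ∑ i : Fin m, ∑ j : Fin m, p' i * M i j * q j ≤ v) ∧
    (∀ q' : Fin m → ℝ, (∀ j : Fin m, 0 ≤ q' j) → (∑ j : Fin m, q' j = 1) →
      v ≤ ∑ i : Fin m, ∑ j : Fin m, p i * M i j * q' j) := by
  have hx : 0 < 1 - z := by linarith
  have hS : 0 < ∑ r ∈ Finset.range m, (1 - z) ^ r :=
    Finset.sum_pos (fun r _ => pow_pos hx r) ⟨0, Finset.mem_range.2 (by omega)⟩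
  have hv0 : 0 < v := by rw [hv]; positivity
  have hrow : ∀ i : Fin m, ∑ j : Fin m, M i j * q j = v := by
    intro i
    rw [← Equiv.sum_comp Fin.revPerm]
    have h := core_fin z m i.rev
    calc _ = v * ∑ j : Fin m, (if j = i.rev then 1 else
              if (j : ℕ) < (i.rev : ℕ) then z else 0) * (1 - z) ^ (j : ℕ) := by
            rw [Finset.mul_sum]
            refine Finset.sum_congr rfl fun j _ => ?_
            have e1 : (i = j.rev) ↔ (j = i.rev) := by
              simp only [Fin.ext_iff, Fin.val_rev]; omega
            have e2 : ((i : ℕ) < (j.rev : ℕ)) ↔ ((j : ℕ) < (i.rev : ℕ)) := by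
              simp only [Fin.val_rev]; omega
            have e3 : m - 1 - (j.rev : ℕ) = j := by
              simp only [Fin.val_rev]; omega
            rw [Fin.revPerm_apply, hM, hq, e3]
            simp only [e1, e2]
            ring
      _ = v := by rw [h, mul_one]
  have hcol : ∀ j : Fin m, ∑ i : Fin m, p i * M i j = v := by
    intro j
    have h := core_fin z m j
    calc _ = v * ∑ i : Fin m, (if i = j then 1 else
              if (i : ℕ) < (j : ℕ) then z else 0) * (1 - z) ^ (i : ℕ) := by
            rw [Finset.mul_sum]
            refine Finset.sum_congr rfl fun i _ => ?_
            rw [hM, hp]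
            ring
      _ = v := by rw [h, mul_one]
  refine ⟨fun j => ?_, ?_, hrow, ?_, ?_⟩
  · rw [hq]; positivity
  · simp only [hq]
    rw [← Finset.mul_sum, ← Finset.sum_range (fun j => (1 - z) ^ (m - 1 - j)),
      Finset.sum_range_reflect (fun j => (1 - z) ^ j), hv]
    field_simp
  · intro p' _ h1
    simp only [mul_assoc, ← Finset.mul_sum, hrow]
    rw [← Finset.sum_mul, h1, one_mul]
  · intro q' _ h1
    rw [Finset.sum_comm]
    simp only [← Finset.sum_mul, hcol]
    rw [← Finset.mul_sum, h1, mul_one]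
end

section
/- Let m ≥ 2 be an integer and z a real with 0 ≤ z < 1. The row player's optimal strategy in the matrix game M_z is uniquely determined: if p ∈ ℝ^m is any mixed strategy such that ∑_{i=1}^m p_i (M_z)_{i,j} ≥ v_z for every column j ∈ {1,…,m}, then p_i = v_z·(1-z)^{i-1} for all i, i.e. p = p^z. -/
/-- Let `m ≥ 2` and `0 ≤ z < 1`. The row player's optimal
strategy in the matrix game `M_z` is uniquely determined: if `p` is any mixed
strategy guaranteeing at least `v_z = 1/∑_{r=0}^{m-1}(1-z)^r` against every
column `j`, then `p_i = v_z·(1-z)^{i-1}` for all `i`, i.e. `p = p^z`. -/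
theorem stmt2 (m : ℕ) (hm : 2 ≤ m) (z : ℝ) (hz0 : 0 ≤ z) (hz1 : z < 1)
    (M : Fin m → Fin m → ℝ)
    (hM : ∀ i j : Fin m, M i j = if i = j then 1 else if (i : ℕ) < (j : ℕ) then z else 0)
    (v : ℝ) (hv : v = 1 / ∑ r ∈ Finset.range m, (1 - z) ^ r)
    (p : Fin m → ℝ) (hp0 : ∀ i : Fin m, 0 ≤ p i) (hp1 : ∑ i : Fin m, p i = 1)
    (hguar : ∀ j : Fin m, v ≤ ∑ i : Fin m, p i * M i j) :
    ∀ i : Fin m, p i = v * (1 - z) ^ (i : ℕ) := by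
  obtain ⟨q, hq⟩ : ∃ q : ℕ → ℝ, ∀ i : Fin m, p i = q i :=
    ⟨fun n => if h : n < m then p ⟨n, h⟩ else 0, fun i => by simp⟩
  have hw : 0 < 1 - z := by linarith
  have hG : 0 < ∑ r ∈ Finset.range m, (1 - z) ^ r :=
    Finset.sum_pos (fun r _ => pow_pos hw r) ⟨0, by simp; omega⟩
  have hS : ∑ i ∈ Finset.range m, q i = 1 := by
    rw [← hp1, ← Fin.sum_univ_eq_sum_range]
    exact Finset.sum_congr rfl (fun i _ => (hq i).symm)
  have hg : ∀ j < m, v ≤ q j + z * ∑ i ∈ Finset.range j, q i := by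
    intro j hj
    have h := hguar ⟨j, hj⟩
    have e : ∑ i : Fin m, p i * M i ⟨j, hj⟩ = q j + z * ∑ i ∈ Finset.range j, q i := by
      have e1 : ∀ i : Fin m, p i * M i ⟨j, hj⟩ =
          (fun n : ℕ => (if n = j then q n else 0) + (if n < j then z * q n else 0)) i := by
        intro i
        rw [hM, hq]
        simp only [Fin.ext_iff]
        split_ifs <;> first | omega | ring
      rw [Finset.sum_congr rfl (fun i _ => e1 i), Fin.sum_univ_eq_sum_range
        (fun n : ℕ => (if n = j then q n else 0) + (if n < j then z * q n else 0)) m,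
        Finset.sum_add_distrib, ← Finset.sum_filter, ← Finset.sum_filter, Finset.mul_sum]
      congr 1
      · rw [Finset.sum_filter, Finset.sum_ite_eq' , if_pos (by simpa using hj)]
      · apply Finset.sum_congr _ (fun _ _ => rfl)
        ext a
        simp only [Finset.mem_filter, Finset.mem_range]
        omega
    rwa [e] at h
  obtain ⟨D, hD⟩ : ∃ D : ℕ → ℝ, ∀ n, D n =
      ∑ i ∈ Finset.range n, q i - v * ∑ r ∈ Finset.range n, (1 - z) ^ r := ⟨_, fun _ => rfl⟩
  have hD0 : D 0 = 0 := by simp [hD]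
  have hDm : D m = 0 := by
    rw [hD, hS, hv]
    field_simp
    ring
  have hstep : ∀ j < m, (1 - z) * D j ≤ D (j + 1) := by
    intro j hj
    have h := hg j hj
    have e : ∑ r ∈ Finset.range (j + 1), (1 - z) ^ r =
        (1 - z) * ∑ r ∈ Finset.range j, (1 - z) ^ r + 1 := by
      rw [Finset.sum_range_succ', Finset.mul_sum]
      simp [pow_succ, mul_comm]
    rw [hD, hD, e, Finset.sum_range_succ]
    linarith
  have hpos : ∀ j ≤ m, 0 ≤ D j := by
    intro j
    induction j with
    | zero => intro _; rw [hD0]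
    | succ k ih =>
      intro hk
      exact (mul_nonneg hw.le (ih (by omega))).trans (hstep k (by omega))
  have hzero : ∀ k j, j + k = m → D j = 0 := by
    intro k
    induction k with
    | zero => intro j hj; rw [← hDm, ← hj]; rfl
    | succ k ih =>
      intro j hj
      have h1 := ih (j + 1) (by omega)
      have h2 := hstep j (by omega)
      have h3 := hpos j (by omega)
      rw [h1] at h2
      by_contra hne
      have := mul_pos hw (lt_of_le_of_ne h3 (Ne.symm hne))
      linarith
  intro i
  have hi := i.isLt
  have h1 := hzero (m - i) i (by omega)
  have h2 := hzero (m - (i + 1)) (i + 1) (by omega)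
  rw [hD] at h1 h2
  rw [Finset.sum_range_succ, Finset.sum_range_succ] at h2
  rw [hq]
  linarith
end

section
/- Let m ≥ 2 and T ≥ 1 be integers, and let (v_t)_{t≥0} be defined by v_0 = 0 and v_{t+1} = 1/(∑_{r=0}^{m-1}(1-v_t)^r). Then v_T < 1 - (1 - 1/m)·(1/(mT))^{1/(m-1)}. -/
theorem purg_step (k : ℕ) (hk : 1 ≤ k) (e A c : ℝ) (he : 0 < e) (he1 : e ≤ 1)
    (hc : c * ((k : ℝ) / (k + 1)) ^ k = 1) (hc0 : 0 < c) (hA : 1 ≤ e ^ k * A) :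
    0 < 1 - 1 / ∑ r ∈ Finset.range (k + 1), e ^ r ∧
    1 - 1 / ∑ r ∈ Finset.range (k + 1), e ^ r ≤ 1 ∧
    1 ≤ (1 - 1 / ∑ r ∈ Finset.range (k + 1), e ^ r) ^ k * (A + k * c) := by
  have hgeom := geom_sum_mul e (k + 1)
  have hS2 : ((k : ℝ) + 1) * e ^ k ≤ ∑ r ∈ Finset.range (k + 1), e ^ r := by
    have h := Finset.card_nsmul_le_sum (Finset.range (k + 1)) (fun r => e ^ r) (e ^ k)
      (fun r hr => pow_le_pow_of_le_one he.le he1 (by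
        have := Finset.mem_range.mp hr
        omega))
    simpa using h
  have hS1 : 1 ≤ ∑ r ∈ Finset.range (k + 1), e ^ r := by
    rw [Finset.sum_range_succ']
    have : 0 ≤ ∑ r ∈ Finset.range k, e ^ (r + 1) :=
      Finset.sum_nonneg (fun r _ => by positivity)
    simpa using this
  generalize (∑ r ∈ Finset.range (k + 1), e ^ r) = S at *
  have hS0 : 0 < S := by linarith
  have hk0 : (1 : ℝ) ≤ k := by exact_mod_cast hk
  have hp : 0 < e ^ k := by positivity
  obtain ⟨x, hx⟩ : ∃ x, x = e ^ k / S := ⟨_, rfl⟩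
  have hxS : x * S = e ^ k := by rw [hx]; field_simp
  have heq : 1 - 1 / S = e * (1 - x) := by
    rw [hx]
    field_simp
    rw [pow_succ] at hgeom
    linarith
  have hx0 : 0 < x := by rw [hx]; positivity
  have hxe : x ≤ e ^ k := by nlinarith
  have hxm : x ≤ 1 / ((k : ℝ) + 1) := by
    rw [hx, div_le_div_iff₀ hS0 (by positivity)]
    linarith
  have hy : (k : ℝ) / (k + 1) ≤ 1 - x := by
    have : (k : ℝ) / (k + 1) = 1 - 1 / (k + 1) := by field_simp; ring
    linarith
  have hy0 : 0 < 1 - x := lt_of_lt_of_le (by positivity) hy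
  have hyc : 1 ≤ (1 - x) ^ k * c := by
    have h : c * ((k : ℝ) / (k + 1)) ^ k ≤ c * (1 - x) ^ k := by gcongr
    linarith
  have hb : 1 - k * x ≤ (1 - x) ^ k := by
    have hx1 : x ≤ 1 := by linarith
    have h := one_add_mul_le_pow (a := -x) (by linarith) k
    have e1 : 1 + -x = 1 - x := by ring
    rw [e1] at h
    linarith
  rw [heq]
  refine ⟨by positivity, by nlinarith, ?_⟩
  rw [mul_pow]
  have hyk : 0 < (1 - x) ^ k := by positivity
  have h1 : (1 - x) ^ k ≤ (1 - x) ^ k * (e ^ k * A) := le_mul_of_one_le_right hyk.le hA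
  have h2 : (e ^ k * k) ≤ (e ^ k * k) * ((1 - x) ^ k * c) :=
    le_mul_of_one_le_right (by positivity) hyc
  have h3 : (k : ℝ) * x ≤ k * e ^ k := by gcongr
  nlinarith

/-- Let `m ≥ 2` and `T ≥ 1` be integers, and let `(v_t)` be the
value-iteration sequence for the one-position generalized Purgatory game
`P(1,m)`: `v 0 = 0` and `v (t+1) = 1/∑_{r=0}^{m-1}(1 - v t)^r`. Then
`v T < 1 - (1 - 1/m)·(1/(mT))^{1/(m-1)}`, where the root is a real power. -/
theorem stmt6 (m T : ℕ) (hm : 2 ≤ m) (hT : 1 ≤ T)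
    (v : ℕ → ℝ) (hv0 : v 0 = 0)
    (hvs : ∀ t : ℕ, v (t + 1) = 1 / ∑ r ∈ Finset.range m, (1 - v t) ^ r) :
    v T < 1 - (1 - 1 / (m : ℝ)) * (1 / ((m : ℝ) * (T : ℝ))) ^ ((1 : ℝ) / ((m : ℝ) - 1)) := by
  obtain ⟨k, rfl⟩ : ∃ k, m = k + 1 := ⟨m - 1, by omega⟩
  have hk : 1 ≤ k := by omega
  have hk0 : (1 : ℝ) ≤ k := by exact_mod_cast hk
  have hT0 : (1 : ℝ) ≤ T := by exact_mod_cast hT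
  obtain ⟨q, hq⟩ : ∃ q : ℝ, q = ((k : ℝ) / (k + 1)) ^ k := ⟨_, rfl⟩
  have hq0 : 0 < q := by rw [hq]; positivity
  have hq1 : q < 1 := by
    rw [hq]
    apply pow_lt_one₀ (by positivity) _ (by omega)
    rw [div_lt_one (by positivity)]
    linarith
  have key : ∀ t : ℕ, 0 < 1 - v t ∧ 1 - v t ≤ 1 ∧
      1 ≤ (1 - v t) ^ k * (1 + t * (k * q⁻¹)) := by
    intro t
    induction t with
    | zero => simp [hv0]
    | succ t ih =>
      obtain ⟨a, b, c⟩ := ih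
      have h := purg_step k hk (1 - v t) _ q⁻¹ a b
        (by rw [← hq]; exact inv_mul_cancel₀ hq0.ne') (by positivity) c
      rw [hvs t]
      refine ⟨h.1, h.2.1, h.2.2.trans_eq ?_⟩
      push_cast
      ring
  obtain ⟨a, -, c⟩ := key T
  push_cast
  have e1 : (1 : ℝ) - 1 / ((k : ℝ) + 1) = k / (k + 1) := by field_simp; ring
  have e2 : (k : ℝ) + 1 - 1 = k := by ring
  rw [e1, e2]
  have hroot : ((1 / (((k : ℝ) + 1) * T)) ^ ((1 : ℝ) / k)) ^ k = 1 / (((k : ℝ) + 1) * T) := by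
    rw [one_div (k : ℝ)]
    exact Real.rpow_inv_natCast_pow (by positivity) (by omega)
  have hlt : ((k : ℝ) / (k + 1) * (1 / (((k : ℝ) + 1) * T)) ^ ((1 : ℝ) / k)) ^ k
      < (1 - v T) ^ k := by
    rw [mul_pow, hroot, ← hq, mul_one_div, div_lt_iff₀ (by positivity)]
    have hp : 0 < (1 - v T) ^ k := by positivity
    have h1 : q ≤ (1 - v T) ^ k * (q + T * k) := by
      have h := mul_le_mul_of_nonneg_left c hq0.le
      have e3 : q * ((1 - v T) ^ k * (1 + T * (k * q⁻¹))) = (1 - v T) ^ k * (q + T * k) := by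
        field_simp
      rw [e3] at h
      linarith
    refine h1.trans_lt ?_
    apply mul_lt_mul_of_pos_left _ hp
    linarith
  have := lt_of_pow_lt_pow_left₀ k a.le hlt
  linarith
end

section
/- Let m ≥ 2 be an integer, let ε be a real with 0 < ε < 1, and let (v_t)_{t≥0} be defined by v_0 = 0 and v_{t+1} = 1/(∑_{r=0}^{m-1}(1-v_t)^r). Then for every integer t ≥ 0 with t < (1/(e·m))·(1/ε)^{m-1}, one has v_t < 1 - ε. (That is, fewer than (1/(em))(1/ε)^{m-1} iterations of value iteration applied to P(1,m) yield a valuation at least ε smaller than the exact value 1, so value iteration needs exponentially many iterations in m even for a game with a single non-terminal position.) -/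
lemma exp_chord (y : ℝ) (h0 : 0 ≤ y) (h1 : y ≤ 1) :
    Real.exp y ≤ 1 + (Real.exp 1 - 1) * y := by
  have h := convexOn_exp.2 (Set.mem_univ (0:ℝ)) (Set.mem_univ (1:ℝ))
    (sub_nonneg.2 h1) h0 (by ring)
  simp only [smul_eq_mul, mul_zero, mul_one, zero_add, Real.exp_zero] at h
  linarith

lemma step_bound (n : ℕ) (hn : 1 ≤ n) (u : ℝ) (h0 : 0 < u) (h1 : u ≤ 1) (u' : ℝ)
    (hu : u' = 1 - 1 / ∑ r ∈ Finset.range (n + 1), u ^ r) :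
    0 < u' ∧ u' ≤ 1 ∧ (1 / u') ^ n ≤ (1 / u) ^ n + (Real.exp 1 - 1) * n := by
  obtain ⟨T, hT⟩ : ∃ T, T = ∑ r ∈ Finset.range n, u ^ r := ⟨_, rfl⟩
  have hS1 : ∑ r ∈ Finset.range (n + 1), u ^ r = T + u ^ n := by
    rw [Finset.sum_range_succ, hT]
  have hS2 : ∑ r ∈ Finset.range (n + 1), u ^ r = u * T + 1 := by
    rw [Finset.sum_range_succ', hT, Finset.mul_sum]
    simp [pow_succ, mul_comm]
  have hx0 : 0 < u ^ n := by positivity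
  have hT1 : 1 ≤ T := by
    rw [hT]
    have := Finset.single_le_sum (f := fun r => u ^ r) (s := Finset.range n)
      (fun i _ => by positivity) (Finset.mem_range.2 hn)
    simpa using this
  have hTn : n * u ^ n ≤ T := by
    rw [hT]
    have := Finset.card_nsmul_le_sum (Finset.range n) (fun r => u ^ r) (u ^ n)
      (fun i hi => pow_le_pow_of_le_one h0.le h1 (Finset.mem_range.1 hi).le)
    simpa using this
  have hTp : 0 < T := by linarith
  have huT : 0 < u * T := by positivity
  have hu2 : u' = u * T / (T + u ^ n) := by
    rw [hu, hS1]
    have : u * T = T + u ^ n - 1 := by linarith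
    rw [this]
    field_simp
  have hup : 0 < u' := by rw [hu2]; positivity
  refine ⟨hup, ?_, ?_⟩
  · rw [hu2, div_le_one (by positivity)]
    nlinarith
  · have e1 : 1 / u' = (1 / u) * (1 + u ^ n / T) := by
      rw [hu2]; field_simp
    have hb : (1 + u ^ n / T) ^ n ≤ 1 + (Real.exp 1 - 1) * (n * (u ^ n / T)) := by
      calc (1 + u ^ n / T) ^ n ≤ (Real.exp (u ^ n / T)) ^ n := by
            apply pow_le_pow_left₀ (by positivity)
            linarith [Real.add_one_le_exp (u ^ n / T)]
        _ = Real.exp (n * (u ^ n / T)) := by rw [← Real.exp_nat_mul]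
        _ ≤ _ := by
            apply exp_chord _ (by positivity)
            rw [← mul_div_assoc, div_le_one hTp]; exact hTn
    have he : 0 ≤ Real.exp 1 - 1 := by linarith [Real.add_one_le_exp (1:ℝ)]
    calc (1 / u') ^ n = (1 / u) ^ n * (1 + u ^ n / T) ^ n := by rw [e1, mul_pow]
      _ ≤ (1 / u) ^ n * (1 + (Real.exp 1 - 1) * (n * (u ^ n / T))) := by gcongr
      _ = (1 / u) ^ n + (Real.exp 1 - 1) * n * (1 / T) := by
          rw [one_div_pow]; field_simp
      _ ≤ _ := by
          have : 1 / T ≤ 1 := by rw [div_le_one hTp]; exact hT1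
          have h2 : 0 ≤ (Real.exp 1 - 1) * n := by positivity
          nlinarith

/-- Let `m ≥ 2`, `0 < ε < 1`, and let `(v_t)` be the
value-iteration sequence for `P(1,m)`: `v 0 = 0` and
`v (t+1) = 1/∑_{r=0}^{m-1}(1 - v t)^r`. Then for every `t` with
`t < (1/(e·m))·(1/ε)^(m-1)` one has `v t < 1 - ε`: fewer than
`(1/(em))(1/ε)^{m-1}` iterations of value iteration on `P(1,m)` yield a
valuation at least `ε` smaller than the exact value `1`. -/
theorem stmt7 (m : ℕ) (hm : 2 ≤ m) (ε : ℝ) (hε0 : 0 < ε) (hε1 : ε < 1)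
    (v : ℕ → ℝ) (hv0 : v 0 = 0)
    (hvs : ∀ t' : ℕ, v (t' + 1) = 1 / ∑ r ∈ Finset.range m, (1 - v t') ^ r)
    (t : ℕ) (ht : (t : ℝ) < (1 / (Real.exp 1 * (m : ℝ))) * (1 / ε) ^ (m - 1)) :
    v t < 1 - ε := by
  obtain ⟨n, rfl⟩ : ∃ n, m = n + 1 := ⟨m - 1, by omega⟩
  have hn : 1 ≤ n := by omega
  have key : ∀ s : ℕ, 0 < 1 - v s ∧ 1 - v s ≤ 1 ∧
      (1 / (1 - v s)) ^ n ≤ 1 + (Real.exp 1 - 1) * n * s := by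
    intro s
    induction s with
    | zero => simp [hv0]
    | succ s ih =>
      obtain ⟨a, b, c⟩ := ih
      obtain ⟨a', b', c'⟩ := step_bound n hn (1 - v s) a b (1 - v (s + 1)) (by rw [hvs])
      refine ⟨a', b', ?_⟩
      push_cast
      linarith
  obtain ⟨a, -, c⟩ := key t
  rcases Nat.eq_zero_or_pos t with h | h
  · subst h; rw [hv0]; linarith
  have he : 1 + 1 ≤ Real.exp 1 := Real.add_one_le_exp (1:ℝ)
  have ht1 : (1:ℝ) ≤ t := by exact_mod_cast h
  have hn0 : (0:ℝ) ≤ n := by positivity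
  rw [Nat.add_sub_cancel, one_div_mul_eq_div, lt_div_iff₀ (by positivity)] at ht
  push_cast at ht
  have hlt : (1 / (1 - v t)) ^ n < (1 / ε) ^ n := by
    have h1 : 0 ≤ (n:ℝ) * t := by positivity
    nlinarith
  have h2 := lt_of_pow_lt_pow_left₀ n (by positivity) hlt
  have h3 := (one_div_lt_one_div a hε0).1 h2
  linarith
end

section
/- Let m ≥ 2 be an integer and let (v_t)_{t≥0} be defined by v_0 = 0 and v_{t+1} = 1/(∑_{r=0}^{m-1}(1-v_t)^r). Then the sequence (v_t) is strictly increasing, satisfies 0 ≤ v_t < 1 for every t, and converges to 1 as t → ∞. -/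
/-- Let `m ≥ 2` and let `(v_t)` be the value-iteration sequence
for `P(1,m)`: `v 0 = 0` and `v (t+1) = 1/∑_{r=0}^{m-1}(1 - v t)^r`. Then `(v_t)`
is strictly increasing, satisfies `0 ≤ v t < 1` for every `t`, and converges to
`1` as `t → ∞`. -/
theorem stmt8 (m : ℕ) (hm : 2 ≤ m)
    (v : ℕ → ℝ) (hv0 : v 0 = 0)
    (hvs : ∀ t : ℕ, v (t + 1) = 1 / ∑ r ∈ Finset.range m, (1 - v t) ^ r) :
    StrictMono v ∧ (∀ t : ℕ, 0 ≤ v t ∧ v t < 1) ∧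
      Filter.Tendsto v Filter.atTop (nhds 1) := by
  have key : ∀ a : ℝ, a * ∑ r ∈ Finset.range m, (1 - a) ^ r = 1 - (1 - a) ^ m := by
    intro a
    have h := mul_neg_geom_sum (1 - a) m
    rwa [sub_sub_cancel] at h
  have hS : ∀ a : ℝ, a < 1 → 1 < ∑ r ∈ Finset.range m, (1 - a) ^ r := by
    intro a ha
    have hx : 0 < 1 - a := by linarith
    have h := Finset.sum_le_sum_of_subset_of_nonneg
      (f := fun r : ℕ => (1 - a) ^ r) (Finset.range_mono hm)
      (fun i _ _ => (pow_pos hx i).le)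
    simp only [Finset.sum_range_succ, Finset.sum_range_zero, pow_zero, pow_one] at h
    linarith
  have hb : ∀ t : ℕ, 0 ≤ v t ∧ v t < 1 := by
    intro t
    induction t with
    | zero => simp [hv0]
    | succ t ih =>
      have h := hS _ ih.2
      rw [hvs t]
      have hpos : 0 < ∑ r ∈ Finset.range m, (1 - v t) ^ r := by linarith
      exact ⟨by positivity, by rw [div_lt_one hpos]; exact h⟩
  have hmono : StrictMono v := by
    apply strictMono_nat_of_lt_succ
    intro t
    have h := hS _ (hb t).2
    have hpos : 0 < ∑ r ∈ Finset.range m, (1 - v t) ^ r := by linarith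
    rw [hvs t, lt_div_iff₀ hpos, key]
    have : 0 < (1 - v t) ^ m := pow_pos (by linarith [(hb t).2]) m
    linarith
  refine ⟨hmono, hb, ?_⟩
  have hbdd : BddAbove (Set.range v) := ⟨1, by rintro _ ⟨t, rfl⟩; exact (hb t).2.le⟩
  have hL := tendsto_atTop_ciSup hmono.monotone hbdd
  generalize (⨆ i, v i) = L at hL
  have hL' : Filter.Tendsto (fun t => v (t + 1)) Filter.atTop (nhds L) :=
    hL.comp (Filter.tendsto_add_atTop_nat 1)
  have hcont : Continuous (fun a : ℝ => ∑ r ∈ Finset.range m, (1 - a) ^ r) := by fun_prop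
  have h1 := hL'.mul ((hcont.tendsto L).comp hL)
  have h2 : ∀ t, v (t + 1) * ((fun a : ℝ => ∑ r ∈ Finset.range m, (1 - a) ^ r) ∘ v) t = 1 := by
    intro t
    have h := hS _ (hb t).2
    have hne : (∑ r ∈ Finset.range m, (1 - v t) ^ r) ≠ 0 := by linarith
    simp only [Function.comp]
    rw [hvs t, one_div, inv_mul_cancel₀ hne]
  simp only [h2] at h1
  have h3 := tendsto_nhds_unique h1 tendsto_const_nhds
  rw [key] at h3
  have h4 : (1 - L) ^ m = 0 := by linarith
  have h5 : 1 - L = 0 := eq_zero_of_pow_eq_zero h4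
  have h6 : L = 1 := by linarith
  rwa [h6] at hL
end

section
/- Let N, m, k, T be integers with N ≥ 2, m ≥ 2, 1 ≤ k ≤ N-2, and 1 ≤ T ≤ 2^(m^(N-k)). Then the value-iteration valuation of the initial position of P(N,m) after T iterations satisfies w^T_1 ≤ 2·m^{-k} + 2^{-m^{N-k-1}}; that is, the value of the T-round time-bounded game P_T(N,m) is at most 2·m^{-k} + 2^{-m^{N-k-1}}. -/
noncomputable def purgF (m : ℕ) (a b : ℝ) : ℝ :=
  if 0 < a then a ^ m / ∑ r ∈ Finset.range m, (a - b) ^ r * a ^ (m - 1 - r) else 0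

lemma purgF_sum_pos {m : ℕ} (hm : 2 ≤ m) {a b : ℝ} (ha : 0 < a) (hba : b ≤ a) :
    0 < ∑ r ∈ Finset.range m, (a - b) ^ r * a ^ (m - 1 - r) := by
  have h0 : 0 ≤ a - b := by linarith
  apply Finset.sum_pos'
  · intro i _
    positivity
  · exact ⟨0, Finset.mem_range.2 (by omega), by simp; positivity⟩

/-- closed form -/
lemma purgF_eq {m : ℕ} (hm : 2 ≤ m) {a b : ℝ} (hb : 0 < b) (hba : b ≤ a) :
    purgF m a b = b / (1 - (1 - b / a) ^ m) := by
  have ha : 0 < a := by linarith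
  have hS := purgF_sum_pos hm ha hba
  unfold purgF
  rw [if_pos ha]
  have hg := (Commute.all (a - b) a).geom_sum₂_mul m
  set S := ∑ r ∈ Finset.range m, (a - b) ^ r * a ^ (m - 1 - r) with hSd
  have h1 : 1 - b / a = (a - b) / a := by field_simp
  rw [h1, div_pow]
  have h2 : a ^ m - (a - b) ^ m = S * b := by linarith
  have h3 : 1 - (a - b) ^ m / a ^ m = S * b / a ^ m := by
    rw [← h2]; field_simp
  rw [h3]
  field_simp

lemma purgF_zero_right {m : ℕ} (hm : 2 ≤ m) {a : ℝ} (ha : 0 < a) :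
    purgF m a 0 = a / m := by
  unfold purgF
  rw [if_pos ha]
  have : ∑ r ∈ Finset.range m, (a - 0) ^ r * a ^ (m - 1 - r) = m * a ^ (m - 1) := by
    rw [Finset.sum_congr rfl (g := fun _ => a ^ (m - 1))]
    · simp
    · intro r hr
      have := Finset.mem_range.1 hr
      rw [sub_zero, ← pow_add]
      congr 1
      omega
  rw [this]
  have h2 : a ^ m = a ^ (m - 1) * a := by
    rw [← pow_succ]; congr 1; omega
  have : (m : ℝ) ≠ 0 := by positivity
  rw [h2]
  field_simp

lemma purgF_mono_left {m : ℕ} (hm : 2 ≤ m) {a a' b : ℝ} (hb : 0 ≤ b) (ha : 0 < a)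
    (hba : b ≤ a) (haa : a ≤ a') : purgF m a b ≤ purgF m a' b := by
  rcases hb.eq_or_lt with h | h
  · subst h
    rw [purgF_zero_right hm ha, purgF_zero_right hm (ha.trans_le haa)]
    gcongr
  · rw [purgF_eq hm h hba, purgF_eq hm h (hba.trans haa)]
    have ha' : 0 < a' := ha.trans_le haa
    have h1 : 0 ≤ 1 - b / a := by
      rw [sub_nonneg, div_le_one ha]; exact hba
    have h2 : 1 - b / a ≤ 1 - b / a' := by gcongr
    have h3 : 1 - b / a' < 1 := by
      have : 0 < b / a' := by positivity
      linarith
    have h4 : (1 - b / a') ^ m < 1 := pow_lt_one₀ (h1.trans h2) h3 (by omega)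
    have h5 : (1 - b / a) ^ m ≤ (1 - b / a') ^ m := by gcongr
    apply div_le_div_of_nonneg_left hb <;> linarith

lemma purgF_mono {m : ℕ} (hm : 2 ≤ m) {a a' b b' : ℝ} (hb : 0 ≤ b)
    (hba : b ≤ a) (haa : a ≤ a') (hbb : b ≤ b') (hba' : b' ≤ a') :
    purgF m a b ≤ purgF m a' b' := by
  rcases (hb.trans hba).eq_or_lt with h | ha
  · subst h
    have : purgF m 0 b = 0 := by simp [purgF]
    rw [this]
    rcases haa.eq_or_lt with h | h
    · subst h; simp [purgF]
    · have := purgF_sum_pos hm h hba'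
      unfold purgF
      rw [if_pos h]
      positivity
  · refine (purgF_mono_left hm hb ha hba haa).trans ?_
    have ha' : 0 < a' := ha.trans_le haa
    have := purgF_sum_pos hm ha' hba'
    have h0 : 0 ≤ a' - b' := by linarith
    unfold purgF
    rw [if_pos ha', if_pos ha']
    gcongr

lemma purgF_nonneg {m : ℕ} (hm : 2 ≤ m) {a b : ℝ} (hba : b ≤ a) :
    0 ≤ purgF m a b := by
  unfold purgF
  split_ifs with h
  · have := purgF_sum_pos hm h hba
    positivity
  · exact le_rfl

lemma purgF_le_self {m : ℕ} (hm : 2 ≤ m) {a b : ℝ} (hb : 0 ≤ b) (hba : b ≤ a) :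
    purgF m a b ≤ a := by
  have h := purgF_mono hm hb hba le_rfl hba le_rfl
  refine h.trans ?_
  rcases (hb.trans hba).eq_or_lt with h | h
  · subst h; simp [purgF]
  · rw [purgF_eq hm h le_rfl, div_self h.ne']
    rw [sub_self, zero_pow (by omega)]; simp

/-- the key inductive estimate -/
lemma purg_bound (N m : ℕ) (hm : 2 ≤ m) (w : ℕ → ℕ → ℝ)
    (hwtop : ∀ t : ℕ, w t (N + 1) = 1)
    (hw0 : ∀ i : ℕ, 1 ≤ i → i ≤ N → w 0 i = 0)
    (hws : ∀ t i : ℕ, 1 ≤ i → i ≤ N → w (t + 1) i = purgF m (w t (i + 1)) (w t 1))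
    (inv : ∀ t i : ℕ, 1 ≤ i → i ≤ N + 1 → 0 ≤ w t 1 ∧ w t 1 ≤ w t i)
    (z : ℝ) (hz0 : 0 < z) (hz1 : z < 1) (t : ℕ) :
    ∀ i, 1 ≤ i → i ≤ N + 1 → w t i ≤ (1 / (1 - (1 - z) ^ m ^ N)) ^ t *
      (z / (1 - (1 - z) ^ m ^ (N + 1 - i))) := by
  have hq : ∀ e : ℕ, 0 < 1 - (1 - z) ^ m ^ e := by
    intro e
    have : (1 - z) ^ m ^ e < 1 := pow_lt_one₀ (by linarith) (by linarith) (by positivity)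
    linarith
  have hq1 : ∀ e : ℕ, 1 - (1 - z) ^ m ^ e ≤ 1 := by
    intro e
    have : 0 ≤ (1 - z) ^ m ^ e := pow_nonneg (by linarith) _
    linarith
  set ρ := 1 / (1 - (1 - z) ^ m ^ N) with hρ
  have hρ1 : 1 ≤ ρ := by
    rw [hρ, le_div_iff₀ (hq N)]; linarith [hq1 N]
  induction t with
  | zero =>
    intro i hi hi'
    rcases Nat.lt_or_ge N i with h | h
    · have : i = N + 1 := by omega
      subst this
      rw [hwtop]
      simp [hz0.ne']
    · rw [hw0 i hi h]
      have := hq (N + 1 - i)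
      positivity
  | succ t ih =>
    intro i hi hi'
    rcases Nat.lt_or_ge N i with h | h
    · have : i = N + 1 := by omega
      subst this
      rw [hwtop]
      simp [hz0.ne']
      exact one_le_pow₀ hρ1
    · rw [hws t i hi h]
      set A := z / (1 - (1 - z) ^ m ^ (N + 1 - (i + 1))) with hA
      have hA0 : 0 < A := by
        have := hq (N + 1 - (i + 1))
        positivity
      have hzA : z ≤ A := by
        rw [hA, le_div_iff₀ (hq _)]
        nlinarith [hq1 (N + 1 - (i + 1))]
      have hρp : 0 < ρ ^ t := by positivity
      have i1 := ih (i + 1) (by omega) (by omega)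
      have i2 := ih 1 le_rfl (by omega)
      rw [← hA] at i1
      have hc : 0 < ρ ^ (t + 1) := by positivity
      have e1 : ρ ^ t * A ≤ ρ ^ (t + 1) * A := by
        gcongr
        omega
      have e2 : ρ ^ t * (z / (1 - (1 - z) ^ m ^ (N + 1 - 1))) = ρ ^ (t + 1) * z := by
        rw [pow_succ, Nat.add_sub_cancel, hρ]; ring
      have inv1 := inv t (i + 1) (by omega) (by omega)
      have M := purgF_mono hm (a' := ρ ^ (t + 1) * A) (b' := ρ ^ (t + 1) * z) inv1.1 inv1.2
        (i1.trans e1) (e2 ▸ i2) (by gcongr)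
      refine M.trans ?_
      rw [purgF_eq hm (by positivity) (by gcongr), mul_div_mul_left _ _ hc.ne']
      have e3 : 1 - z / A = (1 - z) ^ m ^ (N + 1 - (i + 1)) := by
        rw [hA, div_div_cancel₀ hz0.ne']; ring
      have e4 : N + 1 - i = (N + 1 - (i + 1)) + 1 := by omega
      rw [e3, ← pow_mul, ← pow_succ, ← e4, mul_div_assoc]

lemma purg_inv (N m : ℕ) (hm : 2 ≤ m) (hN : 2 ≤ N) (w : ℕ → ℕ → ℝ)
    (hwtop : ∀ t : ℕ, w t (N + 1) = 1)
    (hw0 : ∀ i : ℕ, 1 ≤ i → i ≤ N → w 0 i = 0)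
    (hws : ∀ t i : ℕ, 1 ≤ i → i ≤ N → w (t + 1) i = purgF m (w t (i + 1)) (w t 1))
    (t : ℕ) : 0 ≤ w t 1 ∧ ∀ i j, 1 ≤ i → i ≤ j → j ≤ N + 1 → w t i ≤ w t j := by
  induction t with
  | zero =>
    refine ⟨(hw0 1 le_rfl (by omega)).ge, ?_⟩
    intro i j hi hij hj
    rcases Nat.lt_or_ge N i with h | h
    · have : i = j := by omega
      rw [this]
    · rw [hw0 i hi h]
      rcases Nat.lt_or_ge N j with h' | h'
      · have : j = N + 1 := by omega
        rw [this, hwtop]; exact zero_le_one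
      · rw [hw0 j (by omega) h']
  | succ t ih =>
    obtain ⟨h0, hmon⟩ := ih
    refine ⟨?_, ?_⟩
    · rw [hws t 1 le_rfl (by omega)]
      exact purgF_nonneg hm (hmon 1 2 (by omega) (by omega) (by omega))
    · intro i j hi hij hj
      rcases Nat.lt_or_ge N i with h | h
      · have : i = j := by omega
        rw [this]
      · rw [hws t i hi h]
        have hb := hmon 1 (i + 1) (by omega) (by omega) (by omega)
        rcases Nat.lt_or_ge N j with h' | h'
        · have : j = N + 1 := by omega
          rw [this, hwtop]
          refine (purgF_le_self hm h0 hb).trans ?_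
          rw [← hwtop t]
          exact hmon _ _ (by omega) (by omega) le_rfl
        · rw [hws t j (by omega) h']
          exact purgF_mono hm h0 hb (hmon _ _ (by omega) (by omega) (by omega)) le_rfl
            (hmon _ _ (by omega) (by omega) (by omega))

lemma purg_numeric (N m k T : ℕ) (hm : 2 ≤ m) (hk : k + 2 ≤ N)
    (hT2 : T ≤ 2 ^ m ^ (N - k)) (z : ℝ) (hz : z = 2 * ((m : ℝ) ^ k)⁻¹) (hz0 : 0 < z)
    (hz1 : z < 1) :
    (1 / (1 - (1 - z) ^ m ^ N)) ^ T * (z / (1 - (1 - z) ^ m ^ N)) ≤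
      z + ((2 : ℝ) ^ m ^ (N - k - 1))⁻¹ := by
  set δ := (1 - z) ^ m ^ N with hδ
  set L := m ^ (N - k) with hL
  set l := m ^ (N - k - 1) with hl
  have hl1 : 1 ≤ l := Nat.one_le_pow _ _ (by omega)
  have hLl : 2 * l ≤ L := by
    have : L = l * m := by
      rw [hL, hl, ← pow_succ]; congr 1; omega
    rw [this]; nlinarith
  have hm0 : (0 : ℝ) < m := by positivity
  have hδ0 : 0 ≤ δ := pow_nonneg (by linarith) _
  have hδ6 : δ ≤ (1 / 6 : ℝ) ^ L := by
    have h1 : 1 - z ≤ Real.exp (-z) := Real.one_sub_le_exp_neg z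
    have h2 : δ ≤ Real.exp (-z) ^ m ^ N := pow_le_pow_left₀ (by linarith) h1 _
    have h3 : Real.exp (-z) ^ m ^ N = Real.exp (-2) ^ L := by
      rw [← Real.exp_nat_mul, ← Real.exp_nat_mul]
      congr 1
      have : (m : ℝ) ^ N = (m : ℝ) ^ (N - k) * (m : ℝ) ^ k := by
        rw [← pow_add]; congr 1; omega
      rw [hz, hL]
      push_cast
      rw [this]
      field_simp
    have h4 : Real.exp (-2) ≤ 1 / 6 := by
      rw [Real.exp_neg, one_div]
      apply inv_anti₀ (by norm_num)
      have : Real.exp 2 = Real.exp 1 * Real.exp 1 := by rw [← Real.exp_add]; norm_num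
      rw [this]
      nlinarith [Real.exp_one_gt_d9]
    rw [h3] at h2
    exact h2.trans (pow_le_pow_left₀ (Real.exp_pos _).le h4 _)
  have hTr : (T : ℝ) ≤ 2 ^ L := by exact_mod_cast hT2
  have h2L : (1 : ℝ) ≤ 2 ^ L := one_le_pow₀ (by norm_num)
  have hη : ((T + 1 : ℕ) : ℝ) * δ ≤ 2 * (1 / 3 : ℝ) ^ L := by
    have : ((T + 1 : ℕ) : ℝ) ≤ 2 * 2 ^ L := by push_cast; linarith
    calc ((T + 1 : ℕ) : ℝ) * δ ≤ (2 * 2 ^ L) * (1 / 6 : ℝ) ^ L := by gcongr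
      _ = 2 * (1 / 3 : ℝ) ^ L := by
        rw [mul_assoc, ← mul_pow]; norm_num
  set s := ((2 : ℝ) ^ l)⁻¹ with hs
  have hs0 : 0 < s := by positivity
  have hs1 : s ≤ 1 := inv_le_one_of_one_le₀ (one_le_pow₀ (by norm_num))
  have h3s : 2 * (1 / 3 : ℝ) ^ L ≤ s / 2 := by
    have a1 : (1 / 3 : ℝ) ^ L ≤ (1 / 3 : ℝ) ^ (2 * l) :=
      pow_le_pow_of_le_one (by norm_num) (by norm_num) hLl
    have a2 : (1 / 3 : ℝ) ^ (2 * l) = s * (2 / 9 : ℝ) ^ l := by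
      rw [hs, ← inv_pow, ← mul_pow, pow_mul]; norm_num
    have a3 : (2 / 9 : ℝ) ^ l ≤ (2 / 9 : ℝ) ^ 1 :=
      pow_le_pow_of_le_one (by norm_num) (by norm_num) hl1
    rw [a2] at a1
    nlinarith
  have hδ1 : δ ≤ 1 := pow_le_one₀ (by linarith) (by linarith)
  have hB : 1 - s / 2 ≤ (1 - δ) ^ (T + 1) := by
    have := one_add_mul_le_pow (a := -δ) (by linarith) (T + 1)
    rw [← sub_eq_add_neg] at this
    linarith
  have hpos : 0 < (1 - δ) ^ (T + 1) := by linarith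
  have e : (1 / (1 - δ)) ^ T * (z / (1 - δ)) = z / (1 - δ) ^ (T + 1) := by
    rw [pow_succ, div_pow, one_pow, div_mul_div_comm, one_mul]
  rw [e, div_le_iff₀ hpos]
  have : (z + s) * (1 - s / 2) ≤ (z + s) * (1 - δ) ^ (T + 1) := by gcongr
  nlinarith

/-- Let `N, m, k, T` be integers with `N ≥ 2`, `m ≥ 2`,
`1 ≤ k ≤ N-2` and `1 ≤ T ≤ 2^(m^(N-k))`. Let `(w t i)` be the value-iteration
valuations for the generalized Purgatory game `P(N,m)`, defined via
`F a b = a^m / (∑_{r<m} (a-b)^r·a^{m-1-r})` for `a > 0` and `F a b = 0` for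
`a ≤ 0`, by `w t (N+1) = 1`, `w 0 i = 0` and `w (t+1) i = F (w t (i+1)) (w t 1)`
for `1 ≤ i ≤ N`. Then the valuation of the initial position after `T`
iterations (which equals the value of the `T`-round time-bounded game
`P_T(N,m)`) satisfies `w T 1 ≤ 2·m^{-k} + 2^{-m^{N-k-1}}`. -/
theorem stmt9 (N m k T : ℕ) (hN : 2 ≤ N) (hm : 2 ≤ m)
    (hk1 : 1 ≤ k) (hk2 : k ≤ N - 2) (hT1 : 1 ≤ T) (hT2 : T ≤ 2 ^ m ^ (N - k))
    (F : ℝ → ℝ → ℝ)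
    (hF : ∀ a b : ℝ, F a b =
      if 0 < a then a ^ m / ∑ r ∈ Finset.range m, (a - b) ^ r * a ^ (m - 1 - r) else 0)
    (w : ℕ → ℕ → ℝ)
    (hwtop : ∀ t : ℕ, w t (N + 1) = 1)
    (hw0 : ∀ i : ℕ, 1 ≤ i → i ≤ N → w 0 i = 0)
    (hws : ∀ t i : ℕ, 1 ≤ i → i ≤ N → w (t + 1) i = F (w t (i + 1)) (w t 1)) :
    w T 1 ≤ 2 * ((m : ℝ) ^ k)⁻¹ + ((2 : ℝ) ^ m ^ (N - k - 1))⁻¹ := by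
  have hF' : F = purgF m := by
    funext a b
    rw [hF]
    rfl
  subst hF'
  have inv := purg_inv N m hm hN w hwtop hw0 hws
  have hs0 : 0 < ((2 : ℝ) ^ m ^ (N - k - 1))⁻¹ := by positivity
  have hm0 : (0 : ℝ) < m := by positivity
  by_cases hz1 : 2 * ((m : ℝ) ^ k)⁻¹ < 1
  · have hz0 : 0 < 2 * ((m : ℝ) ^ k)⁻¹ := by positivity
    have h1 := purg_bound N m hm w hwtop hw0 hws
      (fun t i hi hi' => ⟨(inv t).1, (inv t).2 1 i le_rfl hi hi'⟩) _ hz0 hz1 T 1 le_rfl (by omega)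
    rw [Nat.add_sub_cancel] at h1
    exact h1.trans (purg_numeric N m k T hm (by omega) hT2 _ rfl hz0 hz1)
  · have h := (inv T).2 1 (N + 1) le_rfl (by omega) le_rfl
    rw [hwtop] at h
    linarith
end

section
/- Let N ≥ 6 be an even integer and m ≥ 2 an integer. Then for every integer T with 0 ≤ T < 2^(m^(N/2)), the value-iteration valuation of the initial position of P(N,m) after T iterations satisfies w^T_1 ≤ 3·m^{-N/2}. (Thus applying fewer than 2^(m^(N/2)) iterations of value iteration to P(N,m) yields a valuation of the initial position of at most 3·m^{-N/2}, even though the actual value of that position is 1: value iteration has doubly-exponential complexity.) -/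
/-- The value of the matrix game. -/
noncomputable def GG (m : ℕ) (a b : ℝ) : ℝ :=
  if 0 < a then a ^ m / ∑ r ∈ Finset.range m, (a - b) ^ r * a ^ (m - 1 - r) else 0

lemma GG_sum {m : ℕ} (hm : 2 ≤ m) {a b : ℝ} (ha : 0 < a) :
    GG m a b = a / ∑ r ∈ Finset.range m, (1 - b / a) ^ r := by
  have h : ∑ r ∈ Finset.range m, (a - b) ^ r * a ^ (m - 1 - r)
      = a ^ (m - 1) * ∑ r ∈ Finset.range m, (1 - b / a) ^ r := by
    rw [Finset.mul_sum]
    refine Finset.sum_congr rfl fun r hr => ?_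
    have hr' : r ≤ m - 1 := by have := Finset.mem_range.1 hr; omega
    have h1 : a - b = a * (1 - b / a) := by field_simp
    rw [h1, mul_pow]
    have h2 : a ^ (m - 1) = a ^ r * a ^ (m - 1 - r) := by
      rw [← pow_add]; congr 1; omega
    rw [h2]; ring
  have h3 : a ^ m = a ^ (m - 1) * a := by rw [← pow_succ]; congr 1; omega
  rw [GG, if_pos ha, h, h3]
  have : a ^ (m - 1) ≠ 0 := (pow_pos ha _).ne'
  rw [mul_div_mul_left _ _ this]

lemma sum_ge_one {m : ℕ} (hm : 1 ≤ m) {q : ℝ} (hq : 0 ≤ q) :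
    1 ≤ ∑ r ∈ Finset.range m, q ^ r := by
  have := Finset.single_le_sum (f := fun r => q ^ r) (s := Finset.range m)
    (fun i _ => pow_nonneg hq i) (Finset.mem_range.2 (show 0 < m by omega))
  simpa using this

lemma sum_eq {K : ℕ} {q : ℝ} : (∑ r ∈ Finset.range K, q ^ r) * (1 - q) = 1 - q ^ K := by
  have := geom_sum_mul q K
  linarith

lemma q_nonneg {a b : ℝ} (ha : 0 < a) (hb : b ≤ a) : 0 ≤ 1 - b / a := by
  have := (div_le_one ha).2 hb
  linarith

lemma GG_nonneg {m : ℕ} (hm : 2 ≤ m) {a b : ℝ} (hb : b ≤ a) : 0 ≤ GG m a b := by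
  by_cases ha : 0 < a
  · rw [GG_sum hm ha]
    have := sum_ge_one (show 1 ≤ m by omega) (q_nonneg ha hb)
    positivity
  · simp [GG, ha]

lemma GG_le {m : ℕ} (hm : 2 ≤ m) {a b : ℝ} (h0 : 0 ≤ b) (hb : b ≤ a) : GG m a b ≤ a := by
  by_cases ha : 0 < a
  · rw [GG_sum hm ha]
    exact div_le_self ha.le (sum_ge_one (show 1 ≤ m by omega) (q_nonneg ha hb))
  · simp only [GG, ha, if_false]; linarith

lemma GG_pos {m : ℕ} (hm : 2 ≤ m) {a b : ℝ} (h0 : 0 < b) (hb : b ≤ a) :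
    GG m a b = b / (1 - (1 - b / a) ^ m) := by
  have ha : 0 < a := by linarith
  have h1 := sum_ge_one (show 1 ≤ m by omega) (q_nonneg ha hb)
  rw [GG_sum hm ha, ← sum_eq]
  have : ∑ r ∈ Finset.range m, (1 - b / a) ^ r ≠ 0 := by linarith
  generalize ∑ r ∈ Finset.range m, (1 - b / a) ^ r = S at *
  rw [sub_sub_cancel]
  have hb0 : b ≠ 0 := h0.ne'
  field_simp

lemma GG_mono_b {m : ℕ} (hm : 2 ≤ m) {a b b' : ℝ} (hb : b ≤ b') (hb' : b' ≤ a) :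
    GG m a b ≤ GG m a b' := by
  by_cases ha : 0 < a
  · rw [GG_sum hm ha, GG_sum hm ha]
    have h1 := sum_ge_one (show 1 ≤ m by omega) (q_nonneg ha hb')
    apply div_le_div_of_nonneg_left ha.le (by linarith)
    refine Finset.sum_le_sum fun r _ => pow_le_pow_left₀ (q_nonneg ha hb') ?_ r
    have : b / a ≤ b' / a := by gcongr
    linarith
  · simp [GG, ha]

lemma GG_mono_a {m : ℕ} (hm : 2 ≤ m) {a a' b : ℝ} (h0 : 0 ≤ b) (hb : b ≤ a) (h : a ≤ a') :
    GG m a b ≤ GG m a' b := by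
  by_cases ha : 0 < a
  · rcases h0.eq_or_lt with rfl | h0
    · rw [GG_sum hm ha, GG_sum hm (ha.trans_le h)]
      simp only [zero_div, sub_zero, one_pow]
      gcongr
    · rw [GG_pos hm h0 hb, GG_pos hm h0 (hb.trans h)]
      have ha' : 0 < a' := by linarith
      apply div_le_div_of_nonneg_left h0.le
      · have : (1 - b / a') ^ m < 1 := pow_lt_one₀ (q_nonneg ha' (hb.trans h))
          (by have := div_pos h0 ha'; linarith) (by omega)
        linarith
      · have h1 : b / a' ≤ b / a := by gcongr
        have : (1 - b / a) ^ m ≤ (1 - b / a') ^ m :=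
          pow_le_pow_left₀ (q_nonneg ha hb) (by linarith) m
        linarith
  · have := GG_nonneg hm (hb.trans h)
    simpa [GG, ha] using this

/-- Fixed-parameter chain. -/
noncomputable def XX (K : ℕ) (b : ℝ) : ℝ := b / (1 - (1 - b) ^ K)

lemma XX_den {K : ℕ} (hK : 1 ≤ K) {b : ℝ} (h0 : 0 < b) (h1 : b < 1) : 0 < 1 - (1 - b) ^ K := by
  have : (1 - b) ^ K < 1 := pow_lt_one₀ (by linarith) (by linarith) (by omega)
  linarith

lemma XX_ge {K : ℕ} (hK : 1 ≤ K) {b : ℝ} (h0 : 0 < b) (h1 : b < 1) : b ≤ XX K b := by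
  have h2 := XX_den hK h0 h1
  rw [XX, le_div_iff₀ h2]
  have : 0 ≤ (1 - b) ^ K := pow_nonneg (by linarith) _
  nlinarith

lemma XX_step {m K : ℕ} (hm : 2 ≤ m) (hK : 1 ≤ K) {b : ℝ} (h0 : 0 < b) (h1 : b < 1) :
    GG m (XX K b) b = XX (K * m) b := by
  rw [GG_pos hm h0 (XX_ge hK h0 h1)]
  have h2 := XX_den hK h0 h1
  have : 1 - b / XX K b = (1 - b) ^ K := by
    rw [XX]; field_simp; ring
  rw [this, XX, pow_mul]

lemma XX_mono {K : ℕ} (hK : 1 ≤ K) {b b' : ℝ} (h0 : 0 < b) (h : b ≤ b') (h1 : b' < 1) :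
    XX K b ≤ XX K b' := by
  have key : ∀ c : ℝ, 0 < c → XX K c = 1 / ∑ r ∈ Finset.range K, (1 - c) ^ r := by
    intro c hc
    rw [XX, ← sum_eq, sub_sub_cancel, div_mul_cancel_right₀ hc.ne', one_div]
  rw [key b h0, key b' (by linarith)]
  have := sum_ge_one hK (show 0 ≤ 1 - b' by linarith)
  apply div_le_div_of_nonneg_left zero_le_one (by linarith)
  exact Finset.sum_le_sum fun r _ => pow_le_pow_left₀ (by linarith) (by linarith) r

lemma XX_bound {M : ℕ} (hM : 8 ≤ M) {b : ℝ} (h0 : 2 / (M : ℝ) ≤ b) (h1 : b ≤ 3 / (M : ℝ)) :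
    XX (M * M) b ≤ b + 1 / (M * 2 ^ M) := by
  have hM' : (8 : ℝ) ≤ M := by exact_mod_cast hM
  have hb0 : 0 < b := lt_of_lt_of_le (by positivity) h0
  have hb1 : b < 1 := lt_of_le_of_lt h1 (by rw [div_lt_one (by linarith)]; linarith)
  have hK : 1 ≤ M * M := by nlinarith
  have hp : (256 : ℝ) ≤ 2 ^ M := by
    calc (256 : ℝ) = 2 ^ 8 := by norm_num
      _ ≤ 2 ^ M := pow_le_pow_right₀ (by norm_num) hM
  have hbase : (1 - b) ^ M ≤ 1 / 4 := by
    have e1 : 1 - b ≤ Real.exp (-(2 / (M : ℝ))) := by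
      have := Real.add_one_le_exp (-(2 / (M : ℝ)))
      linarith
    have e2 : (1 - b) ^ M ≤ Real.exp (-(2 / (M : ℝ))) ^ M :=
      pow_le_pow_left₀ (by linarith) e1 M
    rw [← Real.exp_nat_mul] at e2
    have e3 : (M : ℝ) * -(2 / (M : ℝ)) = -2 := by field_simp
    rw [e3, Real.exp_neg] at e2
    have e4 : 4 ≤ Real.exp 2 := by
      have := Real.exp_one_gt_d9
      have h : Real.exp 2 = Real.exp 1 * Real.exp 1 := by rw [← Real.exp_add]; norm_num
      rw [h]; nlinarith
    have : (Real.exp 2)⁻¹ ≤ 4⁻¹ := by gcongr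
    linarith
  have hq : (1 - b) ^ (M * M) ≤ 1 / (2 ^ M * 2 ^ M) := by
    rw [pow_mul]
    calc ((1 - b) ^ M) ^ M ≤ (1 / 4) ^ M := pow_le_pow_left₀ (pow_nonneg (by linarith) _) hbase M
      _ = 1 / (2 ^ M * 2 ^ M) := by rw [← mul_pow, one_div_pow]; norm_num
  have hd := XX_den hK hb0 hb1
  rw [XX, div_le_iff₀ hd]
  have hq0 : 0 ≤ (1 - b) ^ (M * M) := pow_nonneg (by linarith) _
  generalize (1 - b) ^ (M * M) = q at *
  generalize (2 : ℝ) ^ M = P at *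
  have hq1 : q ≤ 1 / 2 := hq.trans (by
    rw [div_le_div_iff₀ (by positivity) (by norm_num)]; nlinarith)
  have hbq : b * q ≤ 1 / (2 * (M * P)) := by
    calc b * q ≤ 3 / M * (1 / (P * P)) := by gcongr
      _ = 6 / P * (1 / (2 * (M * P))) := by field_simp; norm_num
      _ ≤ 1 * (1 / (2 * (M * P))) := by
        gcongr
        rw [div_le_one (by linarith)]; linarith
      _ = _ := one_mul _
  have h3 : 1 / (2 * (M * P)) = 1 / (M * P) * (1 / 2) := by field_simp
  have h4 : 1 / (M * P) * (1 / 2) ≤ 1 / (M * P) * (1 - q) := by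
    gcongr; linarith
  linarith


/-- Let `N ≥ 6` be an even integer and `m ≥ 2`. Let `(w t i)`
be the value-iteration valuations for `P(N,m)`, defined via
`F a b = a^m / (∑_{r<m} (a-b)^r·a^{m-1-r})` for `a > 0` and `F a b = 0` for
`a ≤ 0`, by `w t (N+1) = 1`, `w 0 i = 0` and `w (t+1) i = F (w t (i+1)) (w t 1)`
for `1 ≤ i ≤ N`. Then for every `T < 2^(m^(N/2))`, the valuation of the initial
position after `T` iterations satisfies `w T 1 ≤ 3·m^{-N/2}`, even though the
actual value of that position is `1`: value iteration has doubly-exponential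
complexity. -/
theorem stmt10 (N m : ℕ) (hN : 6 ≤ N) (hNeven : Even N) (hm : 2 ≤ m)
    (F : ℝ → ℝ → ℝ)
    (hF : ∀ a b : ℝ, F a b =
      if 0 < a then a ^ m / ∑ r ∈ Finset.range m, (a - b) ^ r * a ^ (m - 1 - r) else 0)
    (w : ℕ → ℕ → ℝ)
    (hwtop : ∀ t : ℕ, w t (N + 1) = 1)
    (hw0 : ∀ i : ℕ, 1 ≤ i → i ≤ N → w 0 i = 0)
    (hws : ∀ t i : ℕ, 1 ≤ i → i ≤ N → w (t + 1) i = F (w t (i + 1)) (w t 1)) :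
    ∀ T : ℕ, T < 2 ^ m ^ (N / 2) → w T 1 ≤ 3 * ((m : ℝ) ^ (N / 2))⁻¹ := by
  have hFG : ∀ a b, F a b = GG m a b := fun a b => by rw [hF, GG]
  simp only [hFG] at hws
  -- monotonicity in the position and nonnegativity
  have hmono : ∀ t, (∀ i, 1 ≤ i → i ≤ N + 1 → 0 ≤ w t i) ∧
      (∀ i, 1 ≤ i → i ≤ N → w t i ≤ w t (i + 1)) ∧
      (∀ i, 1 ≤ i → i ≤ N + 1 → w t 1 ≤ w t i) := by
    have third : ∀ t, (∀ i, 1 ≤ i → i ≤ N → w t i ≤ w t (i + 1)) →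
        (∀ i, 1 ≤ i → i ≤ N + 1 → w t 1 ≤ w t i) := by
      intro t h i hi
      induction i, hi using Nat.le_induction with
      | base => intro _; exact le_rfl
      | succ i hi ih => intro h2; exact (ih (by omega)).trans (h i hi (by omega))
    intro t
    induction t with
    | zero =>
      have a : ∀ i, 1 ≤ i → i ≤ N + 1 → 0 ≤ w 0 i := by
        intro i h1 h2
        rcases h2.eq_or_lt with rfl | h2
        · rw [hwtop]; norm_num
        · rw [hw0 i h1 (by omega)]
      have b : ∀ i, 1 ≤ i → i ≤ N → w 0 i ≤ w 0 (i + 1) := by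
        intro i h1 h2
        rw [hw0 i h1 h2]; exact a _ (by omega) (by omega)
      exact ⟨a, b, third 0 b⟩
    | succ t ih =>
      obtain ⟨ih1, ih2, ih3⟩ := ih
      have a : ∀ i, 1 ≤ i → i ≤ N + 1 → 0 ≤ w (t + 1) i := by
        intro i h1 h2
        rcases h2.eq_or_lt with rfl | h2
        · rw [hwtop]; norm_num
        · rw [hws t i h1 (by omega)]
          exact GG_nonneg hm (ih3 _ (by omega) (by omega))
      have b : ∀ i, 1 ≤ i → i ≤ N → w (t + 1) i ≤ w (t + 1) (i + 1) := by
        intro i h1 h2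
        rw [hws t i h1 h2]
        rcases h2.eq_or_lt with rfl | h2
        · rw [hwtop]
          have := GG_le hm (ih1 1 le_rfl (by omega)) (ih3 (i + 1) (by omega) (by omega))
          rwa [hwtop] at this ⊢
        · rw [hws t (i + 1) (by omega) (by omega)]
          exact GG_mono_a hm (ih1 1 le_rfl (by omega)) (ih3 _ (by omega) (by omega))
            (ih2 _ (by omega) (by omega))
      exact ⟨a, b, third (t + 1) b⟩
  obtain ⟨n, hn⟩ := hNeven
  have hN2 : N / 2 = n := by omega
  rw [hN2]
  obtain ⟨M, hMdef⟩ : ∃ M, M = m ^ n := ⟨_, rfl⟩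
  have hM : 8 ≤ M := by
    rw [hMdef]
    calc 8 = 2 ^ 3 := by norm_num
      _ ≤ m ^ 3 := Nat.pow_le_pow_left hm 3
      _ ≤ m ^ n := Nat.pow_le_pow_right (by omega) (by omega)
  have hMM : m ^ N = M * M := by rw [hMdef, hn, pow_add]
  have hMc : (m : ℝ) ^ n = M := by rw [hMdef]; push_cast; rfl
  rw [hMc, ← hMdef]
  have hM' : (8 : ℝ) ≤ M := by exact_mod_cast hM
  obtain ⟨B, hB⟩ : ∃ B : ℕ → ℝ, ∀ t, B t = 2 / (M : ℝ) + t * (1 / (M * 2 ^ M)) := ⟨_, fun _ => rfl⟩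
  have hBlow : ∀ t, 2 / (M : ℝ) ≤ B t := by
    intro t; rw [hB]
    have : (0 : ℝ) ≤ t * (1 / (M * 2 ^ M)) := by positivity
    linarith
  have hBup : ∀ t, t ≤ 2 ^ M → B t ≤ 3 / M := by
    intro t ht
    have ht' : (t : ℝ) ≤ 2 ^ M := by exact_mod_cast ht
    rw [hB]
    have h1 : (t : ℝ) * (1 / (M * 2 ^ M)) ≤ 2 ^ M * (1 / (M * 2 ^ M)) := by gcongr
    have h2 : (2 : ℝ) ^ M * (1 / (M * 2 ^ M)) = 1 / M := by field_simp
    have h3 : (3 : ℝ) / M = 2 / M + 1 / M := by ring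
    linarith
  have hBpos : ∀ t, 0 < B t := fun t => lt_of_lt_of_le (by positivity) (hBlow t)
  have hBlt : ∀ t, t ≤ 2 ^ M → B t < 1 := fun t ht =>
    lt_of_le_of_lt (hBup t ht) (by rw [div_lt_one (by linarith)]; linarith)
  have hBs : ∀ t, B (t + 1) = B t + 1 / (M * 2 ^ M) := by
    intro t; rw [hB, hB]; push_cast; ring
  have hBmono : ∀ t, B t ≤ B (t + 1) := by
    intro t; rw [hBs]
    have : (0 : ℝ) ≤ 1 / (M * 2 ^ M) := by positivity
    linarith
  have hKpos : ∀ k, 1 ≤ m ^ k := fun k => Nat.one_le_pow _ _ (by omega)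
  have main : ∀ t, t ≤ 2 ^ M → w t 1 ≤ B t ∧
      ∀ i, 2 ≤ i → i ≤ N + 1 → w t i ≤ XX (m ^ (N + 1 - i)) (B t) := by
    intro t
    have top : ∀ t, XX (m ^ (N + 1 - (N + 1))) (B t) = 1 := by
      intro t
      have := (hBpos t).ne'
      simp [XX, this]
    induction t with
    | zero =>
      intro ht
      refine ⟨by rw [hw0 1 le_rfl (by omega)]; exact (hBpos 0).le, fun i h1 h2 => ?_⟩
      rcases h2.eq_or_lt with rfl | h2
      · rw [hwtop, top]
      · rw [hw0 i (by omega) (by omega)]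
        exact (hBpos 0).le.trans (XX_ge (hKpos _) (hBpos 0) (hBlt 0 ht))
    | succ t ih =>
      intro ht
      have ht' : t ≤ 2 ^ M := by omega
      obtain ⟨ih1, ih2⟩ := ih ht'
      obtain ⟨m1, _, m3⟩ := hmono t
      have step : ∀ i, 1 ≤ i → i ≤ N → w (t + 1) i ≤ XX (m ^ (N + 1 - i)) (B t) := by
        intro i h1 h2
        rw [hws t i h1 h2]
        have hX := ih2 (i + 1) (by omega) (by omega)
        have hge := XX_ge (hKpos (N + 1 - (i + 1))) (hBpos t) (hBlt t ht')
        have hst := XX_step hm (hKpos (N + 1 - (i + 1))) (hBpos t) (hBlt t ht')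
        rw [← pow_succ, show N + 1 - (i + 1) + 1 = N + 1 - i by omega] at hst
        rw [← hst]
        exact (GG_mono_a hm (m1 1 le_rfl (by omega)) (m3 _ (by omega) (by omega)) hX).trans
          (GG_mono_b hm ih1 hge)
      refine ⟨?_, fun i h1 h2 => ?_⟩
      · have h := step 1 le_rfl (by omega)
        rw [Nat.add_sub_cancel, hMM] at h
        rw [hBs]
        exact h.trans (XX_bound hM (hBlow t) (hBup t ht'))
      · rcases h2.eq_or_lt with rfl | h2
        · rw [hwtop, top]
        · exact (step i (by omega) (by omega)).trans
            (XX_mono (hKpos _) (hBpos t) (hBmono t) (hBlt _ ht))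
  intro T hT
  rw [← div_eq_mul_inv]
  exact (main T hT.le).1.trans (hBup T hT.le)
end

section
/- Let N ≥ 2 and m ≥ 2 be integers and let (w^t_i) be the value-iteration valuations for P(N,m). Then for all integers t ≥ 0 and all i with 1 ≤ i ≤ N: 0 ≤ w^t_i ≤ w^t_{i+1} ≤ 1 (the valuations are nondecreasing in the position index), and w^t_i ≤ w^{t+1}_i (the valuations are nondecreasing in the number of iterations). -/
lemma den_pos (m : ℕ) (hm : 2 ≤ m) (a b : ℝ) (ha : 0 < a) (hba : b ≤ a) :
    0 < ∑ r ∈ Finset.range m, (a - b) ^ r * a ^ (m - 1 - r) := by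
  have hs : 0 ≤ a - b := sub_nonneg.2 hba
  apply Finset.sum_pos'
  · intro r _
    positivity
  · exact ⟨0, Finset.mem_range.2 (by omega), by simpa using pow_pos ha _⟩

lemma mono_fst (m : ℕ) (hm : 2 ≤ m) (a a' b : ℝ) (ha : 0 < a) (hb : 0 ≤ b) (hba : b ≤ a)
    (haa : a ≤ a') :
    a ^ m / ∑ r ∈ Finset.range m, (a - b) ^ r * a ^ (m - 1 - r) ≤
      a' ^ m / ∑ r ∈ Finset.range m, (a' - b) ^ r * a' ^ (m - 1 - r) := by
  have ha' : 0 < a' := ha.trans_le haa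
  rw [div_le_div_iff₀ (den_pos m hm a b ha hba) (den_pos m hm a' b ha' (hba.trans haa))]
  rcases hb.eq_or_lt with h0 | hpos
  · subst h0
    have key : ∀ x : ℝ, ∑ r ∈ Finset.range m, (x - 0) ^ r * x ^ (m - 1 - r)
        = m * x ^ (m - 1) := by
      intro x
      rw [Finset.sum_congr rfl (g := fun _ => x ^ (m - 1))]
      · simp
      · intro r hr
        have := Finset.mem_range.1 hr
        rw [sub_zero, ← pow_add]
        congr 1
        omega
    rw [key, key]
    obtain ⟨k, rfl⟩ : ∃ k, m = k + 1 := ⟨m - 1, by omega⟩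
    simp only [Nat.add_sub_cancel, pow_succ]
    have : 0 ≤ a ^ k * a' ^ k * ((k + 1 : ℕ) : ℝ) := by positivity
    nlinarith [mul_le_mul_of_nonneg_left haa this]
  · have key : ∀ x : ℝ, (∑ r ∈ Finset.range m, (x - b) ^ r * x ^ (m - 1 - r)) * b
        = x ^ m - (x - b) ^ m := by
      intro x
      have := (Commute.all (x - b) x).geom_sum₂_mul m
      have e : (x - b) - x = -b := by ring
      rw [e] at this
      linarith
    have h1 : (a' * (a - b)) ^ m ≤ (a * (a' - b)) ^ m := by
      apply pow_le_pow_left₀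
      · exact mul_nonneg ha'.le (sub_nonneg.2 hba)
      · nlinarith
    rw [mul_pow, mul_pow] at h1
    refine le_of_mul_le_mul_right ?_ hpos
    rw [mul_assoc, mul_assoc, key, key]
    linarith

lemma mono_snd (m : ℕ) (hm : 2 ≤ m) (a b b' : ℝ) (ha : 0 < a) (hbb : b ≤ b') (hba : b' ≤ a) :
    a ^ m / ∑ r ∈ Finset.range m, (a - b) ^ r * a ^ (m - 1 - r) ≤
      a ^ m / ∑ r ∈ Finset.range m, (a - b') ^ r * a ^ (m - 1 - r) := by
  apply div_le_div_of_nonneg_left (by positivity) (den_pos m hm a b' ha hba)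
  apply Finset.sum_le_sum
  intro r _
  have := sub_nonneg.2 hba
  gcongr

lemma val_le (m : ℕ) (hm : 2 ≤ m) (a b : ℝ) (ha : 0 < a) (hba : b ≤ a) :
    a ^ m / ∑ r ∈ Finset.range m, (a - b) ^ r * a ^ (m - 1 - r) ≤ a := by
  rw [div_le_iff₀ (den_pos m hm a b ha hba)]
  have hs : 0 ≤ a - b := sub_nonneg.2 hba
  have h := Finset.single_le_sum (s := Finset.range m)
    (f := fun r => (a - b) ^ r * a ^ (m - 1 - r)) (fun r _ => by positivity)
    (Finset.mem_range.2 (show 0 < m by omega))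
  simp only [pow_zero, one_mul, Nat.sub_zero] at h
  calc a ^ m = a * a ^ (m - 1) := by rw [← pow_succ']; congr 1; omega
    _ ≤ _ := by gcongr

/-- Let `N ≥ 2`, `m ≥ 2`, and let `(w t i)` be the
value-iteration valuations for `P(N,m)`, defined via
`F a b = a^m / (∑_{r<m} (a-b)^r·a^{m-1-r})` for `a > 0` and `F a b = 0` for
`a ≤ 0`, by `w t (N+1) = 1`, `w 0 i = 0` and `w (t+1) i = F (w t (i+1)) (w t 1)`
for `1 ≤ i ≤ N`. Then for all `t ≥ 0` and all `1 ≤ i ≤ N`: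
`0 ≤ w t i ≤ w t (i+1) ≤ 1` (the valuations are nondecreasing in the position
index), and `w t i ≤ w (t+1) i` (the valuations are nondecreasing in the number
of iterations). -/
theorem stmt11 (N m : ℕ) (hN : 2 ≤ N) (hm : 2 ≤ m)
    (F : ℝ → ℝ → ℝ)
    (hF : ∀ a b : ℝ, F a b =
      if 0 < a then a ^ m / ∑ r ∈ Finset.range m, (a - b) ^ r * a ^ (m - 1 - r) else 0)
    (w : ℕ → ℕ → ℝ)
    (hwtop : ∀ t : ℕ, w t (N + 1) = 1)
    (hw0 : ∀ i : ℕ, 1 ≤ i → i ≤ N → w 0 i = 0)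
    (hws : ∀ t i : ℕ, 1 ≤ i → i ≤ N → w (t + 1) i = F (w t (i + 1)) (w t 1)) :
    ∀ t i : ℕ, 1 ≤ i → i ≤ N →
      0 ≤ w t i ∧ w t i ≤ w t (i + 1) ∧ w t (i + 1) ≤ 1 ∧ w t i ≤ w (t + 1) i := by
  have Fnn : ∀ a b, b ≤ a → 0 ≤ F a b := by
    intro a b hba
    rw [hF]
    split_ifs with ha
    · exact div_nonneg (by positivity) (den_pos m hm a b ha hba).le
    · exact le_rfl
  have Fmono : ∀ a b a' b', 0 ≤ b → b ≤ a → b ≤ b' → a ≤ a' → b' ≤ a' → F a b ≤ F a' b' := by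
    intro a b a' b' hb hba hbb haa hba'
    by_cases ha : 0 < a
    · rw [hF, hF, if_pos ha, if_pos (ha.trans_le haa)]
      exact (mono_fst m hm a a' b ha hb hba haa).trans
        (mono_snd m hm a' b b' (ha.trans_le haa) hbb hba')
    · rw [hF a b, if_neg ha]
      exact Fnn _ _ hba'
  have Fone : ∀ b, b ≤ 1 → F 1 b ≤ 1 := by
    intro b hb
    rw [hF, if_pos one_pos]
    exact val_le m hm 1 b one_pos hb
  -- chain property at a fixed time
  have one_le : ∀ t, (∀ i, 1 ≤ i → i ≤ N → w t i ≤ w t (i + 1)) →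
      ∀ i, 1 ≤ i → i ≤ N + 1 → w t 1 ≤ w t i := by
    intro t h i hi
    induction i, hi using Nat.le_induction with
    | base => intro _; exact le_rfl
    | succ k hk ih => intro hk'; exact (ih (by omega)).trans (h k hk (by omega))
  have chain : ∀ t, (∀ i, 1 ≤ i → i ≤ N → 0 ≤ w t i) ∧
      (∀ i, 1 ≤ i → i ≤ N → w t i ≤ w t (i + 1)) := by
    intro t
    induction t with
    | zero =>
      refine ⟨fun i h1 h2 => (hw0 i h1 h2).ge, fun i h1 h2 => ?_⟩
      rw [hw0 i h1 h2]
      rcases h2.eq_or_lt with rfl | h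
      · rw [hwtop]; exact zero_le_one
      · rw [hw0 (i + 1) (by omega) (by omega)]
    | succ t ih =>
      have hle := one_le t ih.2
      have h0 := ih.1 1 le_rfl (by omega)
      refine ⟨fun i h1 h2 => ?_, fun i h1 h2 => ?_⟩
      · rw [hws t i h1 h2]
        exact Fnn _ _ (hle _ (by omega) (by omega))
      · rw [hws t i h1 h2]
        rcases h2.eq_or_lt with rfl | h
        · rw [hwtop, hwtop]
          apply Fone
          have := hle (i + 1) (by omega) le_rfl
          rwa [hwtop] at this
        · rw [hws t (i + 1) (by omega) (by omega)]
          exact Fmono _ _ _ _ h0 (hle _ (by omega) (by omega)) le_rfl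
            (ih.2 (i + 1) (by omega) (by omega)) (hle _ (by omega) (by omega))
  have le_one : ∀ t i, 1 ≤ i → i ≤ N + 1 → w t i ≤ 1 := by
    intro t i h1 h2
    induction h2 using Nat.decreasingInduction with
    | self => exact (hwtop t).le
    | of_succ k hk ih => exact ((chain t).2 k h1 (by omega)).trans (ih (by omega))
  have time : ∀ t i, 1 ≤ i → i ≤ N + 1 → w t i ≤ w (t + 1) i := by
    intro t
    induction t with
    | zero =>
      intro i h1 h2
      rcases h2.eq_or_lt with rfl | h
      · rw [hwtop, hwtop]
      · rw [hw0 i h1 (by omega)]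
        exact (chain _).1 i h1 (by omega)
    | succ t ih =>
      intro i h1 h2
      rcases h2.eq_or_lt with rfl | h
      · rw [hwtop, hwtop]
      · rw [hws t i h1 (by omega), hws (t + 1) i h1 (by omega)]
        exact Fmono _ _ _ _ ((chain t).1 1 le_rfl (by omega))
          (one_le t (chain t).2 _ (by omega) (by omega)) (ih 1 le_rfl (by omega))
          (ih (i + 1) (by omega) (by omega))
          (one_le (t + 1) (chain (t + 1)).2 _ (by omega) (by omega))
  intro t i h1 h2
  exact ⟨(chain t).1 i h1 h2, (chain t).2 i h1 h2, le_one t (i + 1) (by omega) (by omega),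
    time t i h1 (by omega)⟩
end
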